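/- Let $a < b$ be real numbers and let $f : (a,b) \to \mathbb{R}$ be a continuous function. Suppose there exists a continuous function $F : \Pi \cup (a,b) \to \mathbb{C}$ such that $F$ is holomorphic on $\Pi$, $F$ agrees with $f$ on $(a,b)$, and $\operatorname{Im} F(z) \geq 0$ for all $z \in \Pi$. Then $f$ is matrix monotone on $(a,b)$: for every $n$ and every pair of $n \times n$ Hermitian complex matrices $A, B$ with all eigenvalues in $(a,b)$, if $B - A$ is positive semidefinite, then $f(B) - f(A)$ is positive semidefinite, where $f$ is applied via the functional calculus. -/

import Mathlib

open Matrix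
open scoped ComplexOrder

/-- The functional calculus applied to a Hermitian matrix: writing
`A = U diag(λ₁,…,λₙ) U*` with `U` unitary, `f(A) = U diag(f(λ₁),…,f(λₙ)) U*`. -/
noncomputable def hermApply {n : ℕ} (f : ℝ → ℝ) {A : Matrix (Fin n) (Fin n) ℂ}
    (hA : A.IsHermitian) : Matrix (Fin n) (Fin n) ℂ :=
  (hA.eigenvectorUnitary : Matrix (Fin n) (Fin n) ℂ) *
    Matrix.diagonal (fun i => (f (hA.eigenvalues i) : ℂ)) *
    (star hA.eigenvectorUnitary : Matrix (Fin n) (Fin n) ℂ)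

section Matrices

open scoped MatrixOrder Matrix.Norms.L2Operator

variable {n : ℕ} {A B : Matrix (Fin n) (Fin n) ℂ}

lemma hermApply_eq_cfc (f : ℝ → ℝ) (hA : A.IsHermitian) : hermApply f hA = cfc f A := by
  rw [hA.cfc_eq]
  rfl

lemma isHermitian_hermApply (f : ℝ → ℝ) (hA : A.IsHermitian) : (hermApply f hA).IsHermitian := by
  rw [hermApply_eq_cfc]
  exact cfc_predicate f A

lemma cfc_sub_inv_le_of_lt (hA : A.IsHermitian) (hB : B.IsHermitian) (hAB : A ≤ B) {l : ℝ}
    (hAl : ∀ x ∈ spectrum ℝ A, x < l) (hBl : ∀ x ∈ spectrum ℝ B, x < l) :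
    cfc (fun x : ℝ => (l - x)⁻¹) A ≤ cfc (fun x : ℝ => (l - x)⁻¹) B := by
  have hA' : IsSelfAdjoint A := hA
  have hB' : IsSelfAdjoint B := hB
  rw [cfc_inv (fun x : ℝ => l - x) A (fun x hx => (sub_pos.2 (hAl x hx)).ne'),
    cfc_inv (fun x : ℝ => l - x) B (fun x hx => (sub_pos.2 (hBl x hx)).ne')]
  refine CStarAlgebra.ringInverse_le_ringInverse ?_ ?_
  · rw [cfc_sub (fun _ : ℝ => l) (fun x => x) B, cfc_sub (fun _ : ℝ => l) (fun x => x) A,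
      cfc_const l A, cfc_const l B, cfc_id' ℝ A, cfc_id' ℝ B]
    exact sub_le_sub_left hAB _
  · exact (cfc_isStrictlyPositive_iff _ _).2 fun x hx => sub_pos.2 (hBl x hx)

lemma cfc_sub_inv_le_of_gt (hA : A.IsHermitian) (hB : B.IsHermitian) (hAB : A ≤ B) {l : ℝ}
    (hAl : ∀ x ∈ spectrum ℝ A, l < x) (hBl : ∀ x ∈ spectrum ℝ B, l < x) :
    cfc (fun x : ℝ => (l - x)⁻¹) A ≤ cfc (fun x : ℝ => (l - x)⁻¹) B := by
  have hA' : IsSelfAdjoint A := hA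
  have hB' : IsSelfAdjoint B := hB
  have hneg : (fun x : ℝ => (l - x)⁻¹) = fun x => -(x - l)⁻¹ := by
    ext x
    rw [← inv_neg, neg_sub]
  rw [hneg, cfc_neg (fun x : ℝ => (x - l)⁻¹), cfc_neg (fun x : ℝ => (x - l)⁻¹),
    cfc_inv (fun x : ℝ => x - l) A (fun x hx => (sub_pos.2 (hAl x hx)).ne'),
    cfc_inv (fun x : ℝ => x - l) B (fun x hx => (sub_pos.2 (hBl x hx)).ne')]
  refine neg_le_neg (CStarAlgebra.ringInverse_le_ringInverse ?_ ?_)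
  · rw [cfc_sub (fun x : ℝ => x) (fun _ => l) B, cfc_sub (fun x : ℝ => x) (fun _ => l) A,
      cfc_const l A, cfc_const l B, cfc_id' ℝ A, cfc_id' ℝ B]
    exact sub_le_sub_right hAB _
  · exact (cfc_isStrictlyPositive_iff _ _).2 fun x hx => sub_pos.2 (hAl x hx)

lemma hermApply_sub_inv_posSemidef (hA : A.IsHermitian) (hB : B.IsHermitian)
    (hAB : (B - A).PosSemidef) {l : ℝ}
    (hl : (∀ i, hA.eigenvalues i < l) ∧ (∀ i, hB.eigenvalues i < l) ∨
      (∀ i, l < hA.eigenvalues i) ∧ (∀ i, l < hB.eigenvalues i)) :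
    (hermApply (fun x => (l - x)⁻¹) hB - hermApply (fun x => (l - x)⁻¹) hA).PosSemidef := by
  rw [hermApply_eq_cfc, hermApply_eq_cfc, ← Matrix.le_iff]
  rcases hl with ⟨h₁, h₂⟩ | ⟨h₁, h₂⟩
  · refine cfc_sub_inv_le_of_lt hA hB (Matrix.le_iff.2 hAB) ?_ ?_
    · simpa [hA.spectrum_real_eq_range_eigenvalues] using h₁
    · simpa [hB.spectrum_real_eq_range_eigenvalues] using h₂
  · refine cfc_sub_inv_le_of_gt hA hB (Matrix.le_iff.2 hAB) ?_ ?_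
    · simpa [hA.spectrum_real_eq_range_eigenvalues] using h₁
    · simpa [hB.spectrum_real_eq_range_eigenvalues] using h₂

lemma hermApply_id (hA : A.IsHermitian) : hermApply (fun x => x) hA = A := by
  rw [hermApply_eq_cfc]
  exact cfc_id' ℝ A hA

lemma hermApply_one (hA : A.IsHermitian) : hermApply (fun _ => 1) hA = 1 := by
  rw [hermApply_eq_cfc]
  exact cfc_const_one ℝ A hA

/-- The squared moduli of the coordinates of `v` in the eigenbasis of `A`. -/
noncomputable def eigenWeight (hA : A.IsHermitian) (v : Fin n → ℂ) (i : Fin n) : ℝ :=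
  Complex.normSq (((star hA.eigenvectorUnitary : Matrix (Fin n) (Fin n) ℂ) *ᵥ v) i)

lemma dotProduct_hermApply_mulVec (f : ℝ → ℝ) (hA : A.IsHermitian) (v : Fin n → ℂ) :
    star v ⬝ᵥ hermApply f hA *ᵥ v =
      ((∑ i, eigenWeight hA v i * f (hA.eigenvalues i) : ℝ) : ℂ) := by
  have hstar : star v ᵥ* (hA.eigenvectorUnitary : Matrix (Fin n) (Fin n) ℂ) =
      star ((star hA.eigenvectorUnitary : Matrix (Fin n) (Fin n) ℂ) *ᵥ v) := by
    rw [star_mulVec, star_eq_conjTranspose, conjTranspose_conjTranspose]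
  rw [hermApply, ← mulVec_mulVec, ← mulVec_mulVec, dotProduct_mulVec, hstar]
  simp only [dotProduct, mulVec_diagonal, Complex.ofReal_sum, Complex.ofReal_mul, eigenWeight]
  refine Finset.sum_congr rfl fun i _ => ?_
  rw [Complex.normSq_eq_conj_mul_self, Pi.star_apply, RCLike.star_def]
  ring

end Matrices

section Disc

open Complex Metric Set Filter Topology Real ComplexConjugate

lemma circleAverage_div_mul_conj {G : ℂ → ℂ} (hG : DiffContOnCl ℂ G (ball 0 1))
    {w : ℂ} (hw : w ∈ ball (0 : ℂ) 1) :
    circleAverage (fun z => z / (z - w) * conj (G z)) 0 1 = conj (G 0) := by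
  have hw' : ‖w‖ < 1 := by simpa using hw
  have hne : ∀ z ∈ closedBall (0 : ℂ) 1, 1 - conj w * z ≠ 0 := by
    intro z hz h
    have hz' : ‖z‖ ≤ 1 := by simpa using hz
    have h1 : ‖conj w * z‖ = 1 := by rw [← sub_eq_zero.1 h, norm_one]
    rw [norm_mul, RCLike.norm_conj] at h1
    nlinarith [norm_nonneg w, norm_nonneg z]
  have hH : DiffContOnCl ℂ (fun z => (1 - conj w * z)⁻¹ * G z) (ball 0 1) := by
    have h1 : DiffContOnCl ℂ (fun z : ℂ => 1 - conj w * z) (ball 0 1) :=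
      Differentiable.diffContOnCl (by fun_prop)
    refine DiffContOnCl.smul (h1.inv fun z hz => hne z ?_) hG
    rwa [closure_ball _ one_ne_zero] at hz
  have hav := DiffContOnCl.circleAverage_smul_div (c := 0) (R := 1) (w := 0)
    (by simpa using hH) (by simp)
  have hint : CircleIntegrable (fun z => (1 - conj w * z)⁻¹ * G z) 0 1 := by
    refine ContinuousOn.circleIntegrable zero_le_one ?_
    refine (hH.continuousOn.mono ?_)
    rw [closure_ball _ one_ne_zero]
    exact sphere_subset_closedBall
  have hcomp := (conjCLE : ℂ →L[ℝ] ℂ).circleAverage_comp_comm hint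
  have h2 : circleAverage (fun z => (1 - conj w * z)⁻¹ * G z) 0 1 = G 0 := by
    rw [← show _ = G 0 by simpa using hav]
    refine circleAverage_congr_sphere fun z hz => ?_
    have hz0 : z ≠ 0 := by
      rintro rfl
      simp at hz
    simp [hz0]
  rw [h2] at hcomp
  rw [← show _ = conj (G 0) from hcomp]
  refine circleAverage_congr_sphere fun z hz => ?_
  have hz1 : ‖z‖ = 1 := by simpa using hz
  have hz0 : z ≠ 0 := by
    rintro rfl
    simp at hz1
  have hzc : z * conj z = 1 := by
    rw [mul_conj, normSq_eq_norm_sq, hz1]; simp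
  have hzw : z - w ≠ 0 := by
    rintro h
    rw [sub_eq_zero.1 h] at hz1
    linarith
  have hzw' : 1 - w * conj z ≠ 0 := by
    intro h
    apply hzw
    linear_combination z * h + w * hzc
  simp only [Function.comp_apply, ContinuousLinearEquiv.coe_coe, conjCLE_apply, map_mul, map_inv₀,
    map_sub, map_one, conj_conj]
  congr 1
  field_simp
  linear_combination (-w) * hzc

/-- Schwarz's integral formula on the unit disc. -/
lemma schwarz_integral_formula {G : ℂ → ℂ} (hG : DiffContOnCl ℂ G (ball 0 1))
    {w : ℂ} (hw : w ∈ ball (0 : ℂ) 1) :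
    circleAverage (fun z => z / (z - w) * (2 * I * (G z).im)) 0 1 = G w - conj (G 0) := by
  have hw' : ‖w‖ < 1 := by simpa using hw
  have hGc : ContinuousOn G (sphere 0 1) := by
    refine hG.continuousOn.mono ?_
    rw [closure_ball _ one_ne_zero]
    exact sphere_subset_closedBall
  have hk : ContinuousOn (fun z : ℂ => z / (z - w)) (sphere 0 1) := by
    refine ContinuousOn.div (by fun_prop) (by fun_prop) fun z hz h => ?_
    have hz1 : ‖z‖ = 1 := by simpa using hz
    rw [sub_eq_zero.1 h] at hz1
    linarith
  have h1 := DiffContOnCl.circleAverage_smul_div (c := 0) (R := 1) (w := w)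
    (by simpa using hG) (by simpa using hw)
  have h2 := circleAverage_div_mul_conj hG hw
  rw [← h1, ← h2, ← circleAverage_fun_sub]
  · refine circleAverage_congr_sphere fun z _ => ?_
    simp only [sub_zero, smul_eq_mul]
    rw [← mul_sub, sub_conj]
    push_cast
    ring
  · refine ContinuousOn.circleIntegrable zero_le_one ?_
    simp only [sub_zero, smul_eq_mul]
    exact hk.mul hGc
  · refine ContinuousOn.circleIntegrable zero_le_one ?_
    exact hk.mul (Complex.continuous_conj.comp_continuousOn hGc)

lemma re_sum_eq_circleAverage {ι : Type*} [Fintype ι] {G : ℂ → ℂ}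
    (hG : DiffContOnCl ℂ G (ball 0 1)) {c : ι → ℝ} (hc : ∑ j, c j = 0) {w : ι → ℂ}
    (hw : ∀ j, w j ∈ ball (0 : ℂ) 1) :
    ∑ j, c j * (G (w j)).re =
      circleAverage (fun z => 2 * (G z).im * (I * ∑ j, c j * (z / (z - w j))).re) 0 1 := by
  have hGc : ContinuousOn G (sphere 0 1) := by
    refine hG.continuousOn.mono ?_
    rw [closure_ball _ one_ne_zero]
    exact sphere_subset_closedBall
  have hint : ∀ j ∈ Finset.univ, CircleIntegrable
      (fun z => (c j : ℂ) • (z / (z - w j) * (2 * I * (G z).im))) 0 1 := by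
    intro j _
    refine ContinuousOn.circleIntegrable zero_le_one (ContinuousOn.fun_const_smul ?_ _)
    refine ContinuousOn.mul (ContinuousOn.div (by fun_prop) (by fun_prop) fun z hz h => ?_) ?_
    · have hz1 : ‖z‖ = 1 := by simpa using hz
      have := hw j
      rw [← sub_eq_zero.1 h] at this
      simp [hz1] at this
    · exact continuousOn_const.mul
        (continuous_ofReal.comp_continuousOn (continuous_im.comp_continuousOn hGc))
  have hsum := circleAverage_fun_sum hint
  simp only [circleAverage_fun_smul, schwarz_integral_formula hG (hw _)] at hsum
  have hint' : CircleIntegrable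
      (fun z => ∑ j, (c j : ℂ) • (z / (z - w j) * (2 * I * (G z).im))) 0 1 :=
    CircleIntegrable.fun_sum _ hint
  have hre := reCLM.circleAverage_comp_comm hint'
  rw [hsum] at hre
  have hc' : ∑ j, c j * (G 0).re = 0 := by rw [← Finset.sum_mul, hc, zero_mul]
  calc ∑ j, c j * (G (w j)).re
      = reCLM (∑ j, (c j : ℂ) • (G (w j) - conj (G 0))) := by
        simp [mul_sub, Finset.sum_sub_distrib, hc']
    _ = _ := by
        rw [← hre]
        refine circleAverage_congr_sphere fun z _ => ?_
        simp only [Function.comp_apply, reCLM_apply, smul_eq_mul]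
        rw [← re_ofReal_mul, Finset.mul_sum, Finset.mul_sum]
        congr 1
        refine Finset.sum_congr rfl fun j _ => ?_
        push_cast
        ring

lemma neg_le_re_sum_of_kernel_ge {ι : Type*} [Fintype ι] {G : ℂ → ℂ}
    (hGd : DifferentiableOn ℂ G (ball 0 1)) (hGim : ∀ z ∈ ball (0 : ℂ) 1, 0 ≤ (G z).im)
    {c : ι → ℝ} (hc : ∑ j, c j = 0) {w : ι → ℂ} (hw : ∀ j, w j ∈ ball (0 : ℂ) 1)
    {J K : Set ℂ} (hJ : IsCompact J) (hJK : sphere 0 1 ⊆ J ∪ K)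
    (hJG : ∀ z ∈ J, Tendsto (fun x => (G x).im) (𝓝[ball 0 1] z) (𝓝 0)) {η : ℝ} (hη : 0 ≤ η)
    (hK : ∀ z ∈ K, -η ≤ (I * ∑ j, c j * (z / (z - w j))).re) :
    -(2 * η * (G 0).im) ≤ ∑ j, c j * (G (w j)).re := by
  set Q : ℂ → ℝ := fun z => (I * ∑ j, c j * (z / (z - w j))).re with hQ
  have hQc : ContinuousOn Q (sphere 0 1) := by
    refine continuous_re.comp_continuousOn (continuousOn_const.mul ?_)
    refine continuousOn_finsetSum _ fun j _ => continuousOn_const.mul ?_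
    refine ContinuousOn.div (by fun_prop) (by fun_prop) fun z hz h => ?_
    have hz1 : ‖z‖ = 1 := by simpa using hz
    have := hw j
    rw [← sub_eq_zero.1 h] at this
    simp [hz1] at this
  obtain ⟨M, hM⟩ := (isCompact_sphere (0 : ℂ) 1).exists_bound_of_continuousOn hQc
  have hmaps : ∀ r ∈ Ioo (0 : ℝ) 1, ∀ z ∈ closedBall (0 : ℂ) 1, (r : ℂ) * z ∈ ball (0 : ℂ) 1 := by
    intro r hr z hz
    have hz' : ‖z‖ ≤ 1 := by simpa using hz
    have : ‖(r : ℂ) * z‖ < 1 := by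
      rw [norm_mul, norm_real, norm_of_nonneg hr.1.le]
      nlinarith [hr.1, hr.2, norm_nonneg z]
    simpa using this
  have hr_mem : ∀ᶠ r : ℝ in 𝓝[<] 1, r ∈ Ioo (0 : ℝ) 1 := Ioo_mem_nhdsLT zero_lt_one
  have hlim : Tendsto (fun r : ℝ => ∑ j, c j * (G (r * w j)).re) (𝓝[<] 1)
      (𝓝 (∑ j, c j * (G (w j)).re)) := by
    refine tendsto_finsetSum _ fun j _ => Tendsto.const_mul _ ?_
    have hG1 : ContinuousAt G (w j) :=
      (hGd.differentiableAt (isOpen_ball.mem_nhds (hw j))).continuousAt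
    have hmul : Tendsto (fun r : ℝ => (r : ℂ) * w j) (𝓝[<] 1) (𝓝 (w j)) := by
      have : Continuous fun r : ℝ => (r : ℂ) * w j := by fun_prop
      simpa using (this.tendsto 1).mono_left nhdsWithin_le_nhds
    exact (continuous_re.tendsto _).comp (hG1.tendsto.comp hmul)
  have hbound : ∀ δ > 0, -(2 * η * (G 0).im) - 2 * (δ * M) ≤ ∑ j, c j * (G (w j)).re := by
    intro δ hδ
    have hJr : ∀ᶠ r : ℝ in 𝓝 1, ∀ z ∈ J, (r : ℂ) * z ∈ ball (0 : ℂ) 1 →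
        (G (r * z)).im ≤ δ := by
      refine hJ.eventually_forall_of_forall_eventually fun z hz => ?_
      have hmul : Tendsto (fun p : ℝ × ℂ => (p.1 : ℂ) * p.2) (𝓝 (1, z)) (𝓝 z) := by
        have : Continuous fun p : ℝ × ℂ => (p.1 : ℂ) * p.2 := by fun_prop
        simpa using this.tendsto (1, z)
      have h2 := (hJG z hz).eventually (gt_mem_nhds hδ)
      rw [eventually_nhdsWithin_iff] at h2
      filter_upwards [hmul.eventually h2] with p hp hpm
      exact (hp hpm).le
    refine ge_of_tendsto hlim ?_
    filter_upwards [hr_mem, hJr.filter_mono nhdsWithin_le_nhds] with r hr hrJ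
    have hGr : DiffContOnCl ℂ (fun z => G (r * z)) (ball 0 1) := by
      refine DifferentiableOn.diffContOnCl ?_
      rw [closure_ball _ one_ne_zero]
      exact hGd.comp (by fun_prop) (hmaps r hr)
    have hGrc : ContinuousOn (fun z => G (r * z)) (sphere 0 1) :=
      hGd.continuousOn.comp (by fun_prop)
        fun z hz => hmaps r hr z (sphere_subset_closedBall hz)
    have hcirc : CircleIntegrable (fun z => G (r * z)) 0 1 :=
      hGrc.circleIntegrable zero_le_one
    have hmean : circleAverage (fun z => (G (r * z)).im) 0 1 = (G 0).im := by
      have h1 := imCLM.circleAverage_comp_comm hcirc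
      have h2 := DiffContOnCl.circleAverage (c := 0) (R := 1) (by simpa using hGr)
      rw [h2] at h1
      simpa only [mul_zero] using! h1
    have hci : ContinuousOn (fun z => (G (r * z)).im) (sphere 0 1) :=
      continuous_im.comp_continuousOn hGrc
    rw [re_sum_eq_circleAverage hGr hc hw]
    have hleft : circleAverage (fun z => (-(2 * η)) • (G (r * z)).im - 2 * (δ * M)) 0 1 =
        -(2 * η * (G 0).im) - 2 * (δ * M) := by
      rw [circleAverage_fun_sub, circleAverage_fun_smul, circleAverage_const, hmean, smul_eq_mul]
      · ring
      · exact ContinuousOn.circleIntegrable zero_le_one (hci.fun_const_smul _)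
      · exact ContinuousOn.circleIntegrable zero_le_one continuousOn_const
    rw [← hleft]
    refine circleAverage_mono ?_ ?_ fun z hz => ?_
    · exact ContinuousOn.circleIntegrable zero_le_one
        ((hci.fun_const_smul _).sub continuousOn_const)
    · exact ContinuousOn.circleIntegrable zero_le_one ((continuousOn_const.mul hci).mul hQc)
    · rw [abs_one] at hz
      have hball := hmaps r hr z (sphere_subset_closedBall hz)
      have hu := hGim _ hball
      have hMz : |Q z| ≤ M := hM z hz
      have hM0 : 0 ≤ M := (abs_nonneg _).trans hMz
      change -(2 * η) * (G (r * z)).im - 2 * (δ * M) ≤ 2 * (G (r * z)).im * Q z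
      rcases hJK hz with hzJ | hzK
      · have hd := hrJ z hzJ hball
        have hq := (abs_le.1 hMz).1
        nlinarith [mul_nonneg hη hu, mul_nonneg hu (by linarith : 0 ≤ Q z + M),
          mul_nonneg (sub_nonneg.2 hd) hM0]
      · nlinarith [mul_nonneg hu (by linarith [hK z hzK] : 0 ≤ Q z + η), mul_nonneg hδ.le hM0]
  have hδlim : Tendsto (fun δ : ℝ => -(2 * η * (G 0).im) - 2 * (δ * M)) (𝓝[>] 0)
      (𝓝 (-(2 * η * (G 0).im))) := by
    have : Continuous fun δ : ℝ => -(2 * η * (G 0).im) - 2 * (δ * M) := by fun_prop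
    simpa using (this.tendsto 0).mono_left nhdsWithin_le_nhds
  exact le_of_tendsto hδlim (eventually_nhdsWithin_of_forall hbound)

/-- A finite signed combination of boundary values of a holomorphic function with nonnegative
imaginary part on the disc is nonnegative as soon as its pairing with the Schwarz kernel is, off an
arc on which the imaginary part vanishes. -/
lemma sum_boundary_values_nonneg {ι : Type*} [Fintype ι] {G : ℂ → ℂ}
    (hGd : DifferentiableOn ℂ G (ball 0 1)) (hGim : ∀ z ∈ ball (0 : ℂ) 1, 0 ≤ (G z).im)
    {c : ι → ℝ} (hc : ∑ j, c j = 0) {ω : ι → ℂ} (hω : ∀ j, ‖ω j‖ = 1) {y : ι → ℝ}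
    (hy : ∀ j, Tendsto (fun z => (G z).re) (𝓝[ball 0 1] ω j) (𝓝 (y j)))
    {J K : Set ℂ} (hJ : IsCompact J) (hJK : sphere 0 1 ⊆ J ∪ K)
    (hJG : ∀ z ∈ J, Tendsto (fun x => (G x).im) (𝓝[ball 0 1] z) (𝓝 0))
    (hK : IsCompact K) (hKω : ∀ j, ω j ∉ K)
    (hpos : ∀ z ∈ K, 0 ≤ (I * ∑ j, c j * (z / (z - ω j))).re) :
    0 ≤ ∑ j, c j * y j := by
  have hball : ∀ t ∈ Ioo (0 : ℝ) 1, ∀ j, (t : ℂ) * ω j ∈ ball (0 : ℂ) 1 := by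
    intro t ht j
    simp [hω, abs_of_pos ht.1, ht.2]
  have ht_mem : ∀ᶠ t : ℝ in 𝓝[<] 1, t ∈ Ioo (0 : ℝ) 1 := Ioo_mem_nhdsLT zero_lt_one
  have hlim : Tendsto (fun t : ℝ => ∑ j, c j * (G (t * ω j)).re) (𝓝[<] 1)
      (𝓝 (∑ j, c j * y j)) := by
    refine tendsto_finsetSum _ fun j _ => Tendsto.const_mul _ ((hy j).comp ?_)
    refine tendsto_nhdsWithin_iff.2 ⟨?_, ht_mem.mono fun t ht => hball t ht j⟩
    have : Continuous fun t : ℝ => (t : ℂ) * ω j := by fun_prop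
    simpa using (this.tendsto 1).mono_left nhdsWithin_le_nhds
  have hbound : ∀ η > 0, -(2 * η * (G 0).im) ≤ ∑ j, c j * y j := by
    intro η hη
    have hKt : ∀ᶠ t : ℝ in 𝓝 1, ∀ z ∈ K, -η ≤ (I * ∑ j, c j * (z / (z - t * ω j))).re := by
      refine hK.eventually_forall_of_forall_eventually fun z hz => ?_
      have hcont : ContinuousAt
          (fun p : ℝ × ℂ => (I * ∑ j, c j * (p.2 / (p.2 - p.1 * ω j))).re) (1, z) := by
        refine continuous_re.continuousAt.comp (continuousAt_const.mul ?_)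
        refine tendsto_finsetSum _ fun j _ => continuousAt_const.mul ?_
        refine ContinuousAt.div (by fun_prop) (by fun_prop) fun h => hKω j ?_
        simp only [ofReal_one, one_mul] at h
        rwa [← sub_eq_zero.1 h]
      have hlt : -η < (I * ∑ j, c j * (z / (z - (1 : ℝ) * ω j))).re := by
        simp only [ofReal_one, one_mul]
        linarith [hpos z hz]
      exact (hcont.eventually (lt_mem_nhds hlt)).mono fun p hp => hp.le
    refine ge_of_tendsto hlim ?_
    filter_upwards [ht_mem, hKt.filter_mono nhdsWithin_le_nhds] with t ht htK
    exact neg_le_re_sum_of_kernel_ge hGd hGim hc (hball t ht) hJ hJK hJG hη.le htK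
  have hηlim : Tendsto (fun η : ℝ => -(2 * η * (G 0).im)) (𝓝[>] 0) (𝓝 0) := by
    have : Continuous fun η : ℝ => -(2 * η * (G 0).im) := by fun_prop
    simpa using (this.tendsto 0).mono_left nhdsWithin_le_nhds
  exact le_of_tendsto hηlim (eventually_nhdsWithin_of_forall hbound)

end Disc

section Cayley

open Complex Metric Set Filter Topology

/-- The Cayley transform, from the extended real line to the unit circle. -/
noncomputable def cayley (x : ℝ) : ℂ := (x - I) / (x + I)

/-- The inverse Cayley transform, from the unit disc to the upper half plane. -/
noncomputable def cayleyInv (w : ℂ) : ℂ := I * (1 + w) / (1 - w)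

lemma ofReal_add_I_ne_zero (x : ℝ) : (x : ℂ) + I ≠ 0 := by
  intro h
  simpa using congrArg im h

lemma continuous_cayley : Continuous cayley :=
  Continuous.div (by fun_prop) (by fun_prop) ofReal_add_I_ne_zero

lemma norm_cayley (x : ℝ) : ‖cayley x‖ = 1 := by
  have h : (x : ℂ) - I = (starRingEnd ℂ) (x + I) := by simp [sub_eq_add_neg]
  rw [cayley, norm_div, h, RCLike.norm_conj, div_self (norm_ne_zero_iff.2 (ofReal_add_I_ne_zero x))]

lemma one_sub_cayley (x : ℝ) : 1 - cayley x = 2 * I / (x + I) := by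
  have := ofReal_add_I_ne_zero x
  rw [cayley]
  field_simp
  ring

lemma one_sub_cayley_ne_zero (x : ℝ) : 1 - cayley x ≠ 0 := by
  rw [one_sub_cayley]
  exact div_ne_zero (by simp) (ofReal_add_I_ne_zero x)

lemma cayleyInv_cayley (x : ℝ) : cayleyInv (cayley x) = x := by
  have := ofReal_add_I_ne_zero x
  rw [cayleyInv, one_sub_cayley, cayley]
  field_simp
  ring

lemma neg_two_mul_im_cayley (x : ℝ) :
    -2 * (cayley x).im = x * normSq (1 - cayley x) := by
  have hx : x * x + 1 ≠ 0 := by nlinarith [mul_self_nonneg x]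
  rw [one_sub_cayley, cayley, normSq_div, div_im]
  simp [normSq_apply]
  field_simp
  ring

lemma cayley_eq_of_norm_eq_one {z : ℂ} (hz : ‖z‖ = 1) (hz1 : z ≠ 1) :
    cayley (-2 * z.im / normSq (1 - z)) = z := by
  have hN : normSq (1 - z) ≠ 0 := by
    rw [Ne, normSq_eq_zero, sub_eq_zero]
    exact hz1.symm
  set l := -2 * z.im / normSq (1 - z) with hl
  have hlN : l * normSq (1 - z) = -2 * z.im := div_mul_cancel₀ _ hN
  have hsq : z.re * z.re + z.im * z.im = 1 := by
    rw [← normSq_apply, normSq_eq_norm_sq, hz, one_pow]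
  have hN' : normSq (1 - z) = 2 * (1 - z.re) := by
    rw [normSq_apply]
    simp only [sub_re, one_re, sub_im, one_im]
    linear_combination hsq
  have hu : 1 - z.re ≠ 0 := by
    intro h
    rw [hN', h, mul_zero] at hN
    exact hN rfl
  rw [hN'] at hlN
  have h1 : l * (1 - z.re) = -z.im := by linarith
  have h2 : -(l * z.im) = 1 + z.re := by
    apply mul_right_cancel₀ hu
    linear_combination (-z.im) * h1 + hsq
  rw [cayley, div_eq_iff (ofReal_add_I_ne_zero l)]
  apply Complex.ext
  · simp
    linarith
  · simp
    linarith

lemma cayleyInv_im (w : ℂ) : (cayleyInv w).im = (1 - normSq w) / normSq (1 - w) := by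
  rw [cayleyInv, div_im]
  simp only [normSq_apply, mul_im, mul_re, I_re, I_im, add_re, add_im, one_re, one_im, sub_re,
    sub_im]
  ring

lemma one_sub_ne_zero_of_mem_ball {w : ℂ} (hw : w ∈ ball (0 : ℂ) 1) : 1 - w ≠ 0 := by
  intro h
  rw [← sub_eq_zero.1 h] at hw
  simp at hw

lemma cayleyInv_im_pos {w : ℂ} (hw : w ∈ ball (0 : ℂ) 1) : 0 < (cayleyInv w).im := by
  have hw' : ‖w‖ < 1 := by simpa using hw
  rw [cayleyInv_im, normSq_eq_norm_sq w]
  refine div_pos ?_ (normSq_pos.2 (one_sub_ne_zero_of_mem_ball hw))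
  nlinarith [norm_nonneg w]

lemma tendsto_cayleyInv (x : ℝ) :
    Tendsto cayleyInv (𝓝[ball 0 1] cayley x) (𝓝[{z : ℂ | 0 < z.im}] x) := by
  refine tendsto_nhdsWithin_iff.2 ⟨?_, eventually_nhdsWithin_of_forall fun w => cayleyInv_im_pos⟩
  have : ContinuousAt cayleyInv (cayley x) :=
    ContinuousAt.div (by fun_prop) (by fun_prop) (one_sub_cayley_ne_zero x)
  have h := this.tendsto
  rw [cayleyInv_cayley] at h
  exact h.mono_left nhdsWithin_le_nhds

lemma re_I_mul_kernel_one (x : ℝ) : (I * (1 / (1 - cayley x))).re = x / 2 := by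
  have h : I * (1 / (1 - cayley x)) = (x + I) / 2 := by
    have := ofReal_add_I_ne_zero x
    rw [one_sub_cayley]
    field_simp
  rw [h]
  simp

lemma re_I_mul_kernel {l x : ℝ} (h : l ≠ x) :
    (I * (cayley l / (cayley l - cayley x))).re = (1 + l ^ 2) / 2 * (l - x)⁻¹ - l / 2 := by
  have hlx : (l : ℂ) - x ≠ 0 := sub_ne_zero.2 (by exact_mod_cast h)
  have hlx' : l - x ≠ 0 := sub_ne_zero.2 h
  have hsub : cayley l - cayley x = 2 * I * (l - x) / ((l + I) * (x + I)) := by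
    have h1 := ofReal_add_I_ne_zero x
    have h2 := ofReal_add_I_ne_zero l
    rw [cayley, cayley]
    field_simp
    ring
  have hk : I * (cayley l / (cayley l - cayley x)) =
      (((1 + l ^ 2) / 2 * (l - x)⁻¹ - l / 2 : ℝ) : ℂ) + (1 / 2 : ℝ) * I := by
    have h1 := ofReal_add_I_ne_zero x
    have h2 := ofReal_add_I_ne_zero l
    rw [hsub, cayley]
    push_cast
    field_simp
    ring_nf
    simp only [I_sq]
    ring
  rw [hk, add_re, ofReal_re, re_ofReal_mul, I_re, mul_zero, add_zero]

/-- A signed combination of point evaluations on `(a, b)` that is nonnegative on the functions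
`x ↦ x` and `x ↦ (l - x)⁻¹`, and annihilates constants, is nonnegative on the boundary values of
functions from the upper half plane to its closure. -/
lemma sum_mul_nonneg_of_upperHalfPlane_extension {a b : ℝ} {f : ℝ → ℝ} {F : ℂ → ℂ}
    (hF_cont : ContinuousOn F ({z : ℂ | 0 < z.im} ∪ (Complex.ofReal '' Set.Ioo a b)))
    (hF_holo : DifferentiableOn ℂ F {z : ℂ | 0 < z.im})
    (hF_agree : ∀ x ∈ Set.Ioo a b, F (x : ℂ) = (f x : ℂ))
    (hF_im : ∀ z ∈ {z : ℂ | 0 < z.im}, 0 ≤ (F z).im)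
    {ι : Type*} [Fintype ι] {c x : ι → ℝ} (hx : ∀ j, x j ∈ Ioo a b) (hc : ∑ j, c j = 0)
    (hcx : 0 ≤ ∑ j, c j * x j)
    (hcl : ∀ l, ((∀ j, x j < l) ∨ ∀ j, l < x j) → 0 ≤ ∑ j, c j * (l - x j)⁻¹) :
    0 ≤ ∑ j, c j * f (x j) := by
  obtain ⟨a', ha'x, ha'⟩ : ∃ a', (∀ j, a' < x j) ∧ a < a' := by
    have h : ∀ᶠ t in 𝓝[>] a, ∀ j, t < x j :=
      (eventually_all.2 fun j => gt_mem_nhds (hx j).1).filter_mono nhdsWithin_le_nhds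
    exact (h.and self_mem_nhdsWithin).exists
  obtain ⟨b', hb'x, hb'⟩ : ∃ b', (∀ j, x j < b') ∧ b' < b := by
    have h : ∀ᶠ t in 𝓝[<] b, ∀ j, x j < t :=
      (eventually_all.2 fun j => lt_mem_nhds (hx j).2).filter_mono nhdsWithin_le_nhds
    exact (h.and self_mem_nhdsWithin).exists
  have hlim : ∀ l ∈ Ioo a b,
      Tendsto (fun w => F (cayleyInv w)) (𝓝[ball 0 1] cayley l) (𝓝 (f l)) := by
    intro l hl
    have h := (hF_cont l (Or.inr ⟨l, hl, rfl⟩)).mono subset_union_left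
    rw [ContinuousWithinAt, hF_agree l hl] at h
    exact h.comp (tendsto_cayleyInv l)
  set V : Set ℂ := {z | a' * normSq (1 - z) < -2 * z.im ∧ -2 * z.im < b' * normSq (1 - z)} with hV
  have hVo : IsOpen V := by
    have h1 : Continuous fun z : ℂ => normSq (1 - z) := continuous_normSq.comp (by fun_prop)
    have h2 : Continuous fun z : ℂ => -2 * z.im := continuous_const.mul continuous_im
    exact (isOpen_lt (continuous_const.mul h1) h2).inter (isOpen_lt h2 (continuous_const.mul h1))
  refine sum_boundary_values_nonneg (G := fun w => F (cayleyInv w)) (ω := fun j => cayley (x j))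
    (J := cayley '' Icc a' b') (K := sphere 0 1 \ V) ?_ (fun z hz => hF_im _ (cayleyInv_im_pos hz))
    hc (fun j => norm_cayley _) (fun j => ?_) (isCompact_Icc.image continuous_cayley) ?_ ?_
    ((isCompact_sphere 0 1).diff hVo) (fun j hj => hj.2 ?_) ?_
  · refine hF_holo.comp (t := {z : ℂ | 0 < z.im}) ?_ fun z hz => cayleyInv_im_pos hz
    exact DifferentiableOn.div (by fun_prop) (by fun_prop) fun z hz =>
      one_sub_ne_zero_of_mem_ball hz
  · simpa [Function.comp_def] using (continuous_re.tendsto _).comp (hlim (x j) (hx j))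
  · intro z hz
    by_cases hzV : z ∈ V
    · left
      have hz1 : z ≠ 1 := by
        rintro rfl
        simp [hV] at hzV
      have hN : 0 < normSq (1 - z) := normSq_pos.2 (sub_ne_zero.2 hz1.symm)
      exact ⟨_, ⟨((lt_div_iff₀ hN).2 hzV.1).le, ((div_lt_iff₀ hN).2 hzV.2).le⟩,
        cayley_eq_of_norm_eq_one (by simpa using hz) hz1⟩
    · exact Or.inr ⟨hz, hzV⟩
  · rintro _ ⟨l, hl, rfl⟩
    simpa [Function.comp_def] using (continuous_im.tendsto _).comp (hlim l ⟨ha'.trans_le hl.1, hl.2.trans_lt hb'⟩)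
  · have hN : 0 < normSq (1 - cayley (x j)) := normSq_pos.2 (one_sub_cayley_ne_zero _)
    rw [hV, mem_ofPred_eq, neg_two_mul_im_cayley]
    exact ⟨mul_lt_mul_of_pos_right (ha'x j) hN, mul_lt_mul_of_pos_right (hb'x j) hN⟩
  · rintro z ⟨hz, hzV⟩
    have hre : (I * ∑ j, c j * (z / (z - cayley (x j)))).re =
        ∑ j, c j * (I * (z / (z - cayley (x j)))).re := by
      rw [Finset.mul_sum, re_sum]
      refine Finset.sum_congr rfl fun j _ => ?_
      rw [← re_ofReal_mul]
      congr 1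
      ring
    rw [hre]
    by_cases hz1 : z = 1
    · subst hz1
      simp_rw [re_I_mul_kernel_one, ← mul_div_assoc]
      rw [← Finset.sum_div]
      exact div_nonneg hcx zero_le_two
    have hN : 0 < normSq (1 - z) := normSq_pos.2 (sub_ne_zero.2 (Ne.symm hz1))
    have hzl := cayley_eq_of_norm_eq_one (by simpa using hz) hz1
    set l := -2 * z.im / normSq (1 - z) with hl
    have hlx : (∀ j, x j < l) ∨ ∀ j, l < x j := by
      by_cases h : a' < l
      · refine Or.inl fun j => (hb'x j).trans_le (not_lt.1 fun h' => hzV ?_)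
        exact ⟨(lt_div_iff₀ hN).1 h, (div_lt_iff₀ hN).1 h'⟩
      · exact Or.inr fun j => (not_lt.1 h).trans_lt (ha'x j)
    have hne : ∀ j, l ≠ x j := fun j => hlx.elim (fun h => (h j).ne') fun h => (h j).ne
    have hsum : ∑ j, c j * (I * (z / (z - cayley (x j)))).re =
        (1 + l ^ 2) / 2 * ∑ j, c j * (l - x j)⁻¹ - l / 2 * ∑ j, c j := by
      rw [← hzl, Finset.mul_sum, Finset.mul_sum, ← Finset.sum_sub_distrib]
      refine Finset.sum_congr rfl fun j _ => ?_
      rw [re_I_mul_kernel (hne j)]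
      ring
    rw [hsum, hc, mul_zero, sub_zero]
    exact mul_nonneg (by positivity) (hcl l hlx)

end Cayley

/-- **The easy direction of Löwner's theorem.** If a continuous function
`f : (a, b) → ℝ` extends continuously to the upper half plane `Π` as a function
into `closure Π` which is holomorphic on `Π`, then `f` is matrix monotone. -/
theorem matrixMonotone_of_upperHalfPlane_extension (a b : ℝ) (hab : a < b) (f : ℝ → ℝ)
    (hf_cont : ContinuousOn f (Set.Ioo a b))
    (F : ℂ → ℂ)
    (hF_cont : ContinuousOn F ({z : ℂ | 0 < z.im} ∪ (Complex.ofReal '' Set.Ioo a b)))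
    (hF_holo : DifferentiableOn ℂ F {z : ℂ | 0 < z.im})
    (hF_agree : ∀ x ∈ Set.Ioo a b, F (x : ℂ) = (f x : ℂ))
    (hF_im : ∀ z ∈ {z : ℂ | 0 < z.im}, 0 ≤ (F z).im) :
    ∀ (n : ℕ) (A B : Matrix (Fin n) (Fin n) ℂ) (hA : A.IsHermitian) (hB : B.IsHermitian),
      (∀ i, hA.eigenvalues i ∈ Set.Ioo a b) → (∀ i, hB.eigenvalues i ∈ Set.Ioo a b) →
      (B - A).PosSemidef → (hermApply f hB - hermApply f hA).PosSemidef := by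
  intro n A B hA hB hAσ hBσ hAB
  rw [Matrix.posSemidef_iff_dotProduct_mulVec]
  refine ⟨(isHermitian_hermApply f hB).sub (isHermitian_hermApply f hA), fun v => ?_⟩
  set c : Fin n ⊕ Fin n → ℝ := Sum.elim (eigenWeight hB v) fun i => -eigenWeight hA v i with hc
  set x : Fin n ⊕ Fin n → ℝ := Sum.elim hB.eigenvalues hA.eigenvalues with hx
  have key : ∀ g : ℝ → ℝ, star v ⬝ᵥ (hermApply g hB - hermApply g hA) *ᵥ v =
      ((∑ j, c j * g (x j) : ℝ) : ℂ) := by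
    intro g
    rw [Matrix.sub_mulVec, dotProduct_sub, dotProduct_hermApply_mulVec,
      dotProduct_hermApply_mulVec, ← Complex.ofReal_sub, Fintype.sum_sum_type]
    simp [hc, hx, sub_eq_add_neg]
  have nonneg : ∀ g : ℝ → ℝ, (hermApply g hB - hermApply g hA).PosSemidef →
      0 ≤ ∑ j, c j * g (x j) := by
    intro g hg
    have h := hg.dotProduct_mulVec_nonneg v
    rw [key] at h
    exact_mod_cast h
  rw [key]
  refine Complex.zero_le_real.2 (sum_mul_nonneg_of_upperHalfPlane_extension hF_cont hF_holo
    hF_agree hF_im ?_ ?_ ?_ fun l hl => ?_)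
  · rintro (i | i)
    · exact hBσ i
    · exact hAσ i
  · have h := key fun _ => 1
    rw [hermApply_one, hermApply_one, sub_self, Matrix.zero_mulVec, dotProduct_zero] at h
    simpa using (Complex.ofReal_eq_zero.1 h.symm)
  · refine nonneg (fun t => t) ?_
    rwa [hermApply_id, hermApply_id]
  · refine nonneg (fun t => (l - t)⁻¹) (hermApply_sub_inv_posSemidef hA hB hAB ?_)
    exact hl.imp (fun h => ⟨fun i => h (Sum.inr i), fun i => h (Sum.inl i)⟩)
      fun h => ⟨fun i => h (Sum.inr i), fun i => h (Sum.inl i)⟩
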